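/- Let F be L-Lipschitz on the support of μ. If there exists ε > 0 such that s := (1/4)(1+ε) C_P(μ) L² < 1, then the perturbed measure μ_F satisfies a Poincaré inequality with C_P(μ_F) ≤ (1 + ε⁻¹) C_P(μ) / (1 − s). -/

import Mathlib

open MeasureTheory Real Set
open scoped ENNReal RealInnerProductSpace Pointwise Matrix

noncomputable section

/-- Euclidean space ℝ^n. -/
abbrev En (n : ℕ) := EuclideanSpace ℝ (Fin n)

/-- Test functions: smooth, bounded and Lipschitz. -/
def IsTestFun {n : ℕ} (f : En n → ℝ) : Prop :=
  ContDiff ℝ (⊤ : ℕ∞) f ∧ (∃ M, ∀ x, |f x| ≤ M) ∧ ∃ L, LipschitzWith L f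

/-- `μ` satisfies a Poincaré inequality with constant `C`. -/
def PoincareLE {n : ℕ} (μ : Measure (En n)) (C : ℝ) : Prop :=
  ∀ f : En n → ℝ, IsTestFun f →
    (∫ x, (f x) ^ 2 ∂μ) - (∫ x, f x ∂μ) ^ 2 ≤ C * ∫ x, ‖gradient f x‖ ^ 2 ∂μ

/-- `μ` satisfies a logarithmic Sobolev inequality with constant `C`. -/
def LogSobolevLE {n : ℕ} (μ : Measure (En n)) (C : ℝ) : Prop :=
  ∀ f : En n → ℝ, IsTestFun f →
    (∫ x, (f x) ^ 2 * Real.log ((f x) ^ 2) ∂μ)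
        - (∫ x, (f x) ^ 2 ∂μ) * Real.log (∫ x, (f x) ^ 2 ∂μ)
      ≤ C * ∫ x, ‖gradient f x‖ ^ 2 ∂μ

/-- `μ` satisfies an L¹-Poincaré inequality (around the mean) with constant `C`. -/
def CheegerMeanLE {n : ℕ} (μ : Measure (En n)) (C : ℝ) : Prop :=
  ∀ f : En n → ℝ, IsTestFun f →
    ∫ x, |f x - ∫ y, f y ∂μ| ∂μ ≤ C * ∫ x, ‖gradient f x‖ ∂μ

/-- `m` is a median of `f` under `μ`. -/
def IsMedian {n : ℕ} (μ : Measure (En n)) (f : En n → ℝ) (m : ℝ) : Prop :=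
  ENNReal.ofReal (1 / 2) ≤ μ {x | f x ≤ m} ∧ ENNReal.ofReal (1 / 2) ≤ μ {x | m ≤ f x}

/-- `μ` satisfies a Cheeger inequality (around medians) with constant `C`. -/
def CheegerMedianLE {n : ℕ} (μ : Measure (En n)) (C : ℝ) : Prop :=
  ∀ f : En n → ℝ, IsTestFun f → ∀ m : ℝ, IsMedian μ f m →
    ∫ x, |f x - m| ∂μ ≤ C * ∫ x, ‖gradient f x‖ ∂μ

/-- The perturbed (normalized) measure `μ_F = Z_F⁻¹ e^{-F} μ`. -/
def perturb {n : ℕ} (μ : Measure (En n)) (F : En n → ℝ) : Measure (En n) :=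
  (ENNReal.ofReal (∫ x, Real.exp (-F x) ∂μ))⁻¹ •
    μ.withDensity fun x => ENNReal.ofReal (Real.exp (-F x))

/-- Topological support of a measure. -/
def measSupport {n : ℕ} (μ : Measure (En n)) : Set (En n) :=
  {x | ∀ U ∈ nhds x, 0 < μ U}

/-- `μ` is log-concave: it has density `e^{-W}` on a convex set, with `W` convex
(equivalently, density `e^{-W}` with `W : ℝⁿ → ℝ ∪ {+∞}` convex). -/
def IsLogConcave {n : ℕ} (μ : Measure (En n)) : Prop :=
  ∃ (s : Set (En n)) (W : En n → ℝ), Convex ℝ s ∧ ConvexOn ℝ s W ∧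
    μ = volume.withDensity (s.indicator fun x => ENNReal.ofReal (Real.exp (-W x)))

/-- The Laplacian of `F`. -/
def laplacian {n : ℕ} (F : En n → ℝ) (x : En n) : ℝ :=
  ∑ i : Fin n,
    fderiv ℝ (fun y => fderiv ℝ F y (EuclideanSpace.single i (1 : ℝ))) x
      (EuclideanSpace.single i (1 : ℝ))

/-- The generator `A F = ΔF - ∇V·∇F` associated with `μ = e^{-V} dx`. -/
def genA {n : ℕ} (V F : En n → ℝ) (x : En n) : ℝ :=
  laplacian F x - ⟪gradient V x, gradient F x⟫

/-- The centered Gaussian measure on ℝ^n with covariance matrix `σ² Id`. -/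
def gaussMeasure (n : ℕ) (σ : ℝ) : Measure (En n) :=
  volume.withDensity fun x =>
    ENNReal.ofReal ((2 * π * σ ^ 2) ^ (-(n : ℝ) / 2) * Real.exp (-‖x‖ ^ 2 / (2 * σ ^ 2)))

/-- Convolution of two measures. -/
def mconv {n : ℕ} (μ ν : Measure (En n)) : Measure (En n) :=
  (μ.prod ν).map fun p => p.1 + p.2

/-- Concentration profile of `μ`. -/
def concProfile {n : ℕ} (μ : Measure (En n)) (r : ℝ) : ℝ :=
  sSup {t | ∃ A : Set (En n), MeasurableSet A ∧ (1 : ℝ) / 2 ≤ (μ A).toReal ∧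
    t = 1 - (μ (A + Metric.ball (0 : En n) r)).toReal}

/-- Generalized inverse of the concentration profile. -/
def concInv {n : ℕ} (μ : Measure (En n)) (s : ℝ) : ℝ :=
  sInf {r | 0 < r ∧ concProfile μ r ≤ s}

/-- The Hessian matrix of `V` at `x`. -/
def hessMat {n : ℕ} (V : En n → ℝ) (x : En n) : Matrix (Fin n) (Fin n) ℝ :=
  fun i j =>
    fderiv ℝ (fun y => fderiv ℝ V y (EuclideanSpace.single j (1 : ℝ))) x
      (EuclideanSpace.single i (1 : ℝ))

end


open scoped Topology Convolution

section PoincarePerturbation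

variable {n : ℕ}

/-- A Lipschitz function is uniformly approximated by its mollifications, which are smooth and
Lipschitz with the same constant. -/
theorem LipschitzWith.exists_contDiff_abs_sub_le {g : En n → ℝ} {K : NNReal}
    (hg : LipschitzWith K g) {δ : ℝ} (hδ : 0 < δ) :
    ∃ h : En n → ℝ, ContDiff ℝ (⊤ : ℕ∞) h ∧ LipschitzWith K h ∧ ∀ x, |h x - g x| ≤ K * δ := by
  let φ : ContDiffBump (0 : En n) := ⟨δ / 2, δ, by positivity, by linarith⟩
  have hloc : LocallyIntegrable g (volume : Measure (En n)) := hg.continuous.locallyIntegrable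
  have hint : ∀ x : En n, Integrable (fun t => φ.normed volume t * g (x - t)) volume := fun x =>
    (φ.hasCompactSupport_normed.convolutionExists_left (ContinuousLinearMap.lsmul ℝ ℝ)
      φ.continuous_normed hloc x)
  refine ⟨φ.normed volume ⋆[ContinuousLinearMap.lsmul ℝ ℝ, volume] g,
    φ.hasCompactSupport_normed.contDiff_convolution_left _ φ.contDiff_normed hloc,
    LipschitzWith.of_dist_le_mul fun x y => ?_, fun x => ?_⟩
  · rw [dist_eq_norm]
    change ‖(∫ t, φ.normed volume t * g (x - t)) - ∫ t, φ.normed volume t * g (y - t)‖ ≤ _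
    rw [← integral_sub (hint x) (hint y)]
    refine (norm_integral_le_of_norm_le (φ.integrable_normed.mul_const (K * dist x y))
      (.of_forall fun t => ?_)).trans_eq ?_
    · rw [← mul_sub, norm_mul, Real.norm_of_nonneg (φ.nonneg_normed t), ← dist_eq_norm]
      refine mul_le_mul_of_nonneg_left ?_ (φ.nonneg_normed t)
      simpa using hg.dist_le_mul (x - t) (y - t)
    · rw [integral_mul_const, φ.integral_normed, one_mul]
  · rw [← Real.dist_eq]
    refine φ.dist_normed_convolution_le hg.continuous.aestronglyMeasurable fun y hy => ?_
    refine (hg.dist_le_mul y x).trans ?_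
    gcongr
    exact (Metric.mem_ball.1 hy).le

theorem norm_gradient_eq_norm_fderiv (f : En n → ℝ) (x : En n) :
    ‖gradient f x‖ = ‖fderiv ℝ f x‖ := by
  simp [gradient]

theorem IsTestFun.differentiable {f : En n → ℝ} (hf : IsTestFun f) : Differentiable ℝ f :=
  hf.1.differentiable (by simp)

theorem IsTestFun.continuous_norm_gradient {f : En n → ℝ} (hf : IsTestFun f) :
    Continuous fun x => ‖gradient f x‖ := by
  simp_rw [norm_gradient_eq_norm_fderiv]
  exact (hf.1.continuous_fderiv (by simp)).norm

theorem IsTestFun.exists_norm_gradient_le {f : En n → ℝ} (hf : IsTestFun f) :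
    ∃ K : ℝ, ∀ x, ‖gradient f x‖ ≤ K := by
  obtain ⟨K, hK⟩ := hf.2.2
  exact ⟨K, fun x => norm_gradient_eq_norm_fderiv f x ▸ norm_fderiv_le_of_lipschitz ℝ hK⟩

/-- The gradient of `(f - c) e^{-G/2}` is controlled by those of `f` and `G`. -/
theorem norm_gradient_sub_const_mul_exp_le {f G : En n → ℝ} {x : En n}
    (hf : DifferentiableAt ℝ f x) (hG : DifferentiableAt ℝ G x) (c : ℝ) :
    ‖gradient (fun y => (f y - c) * Real.exp (-G y / 2)) x‖ ≤
      (‖gradient f x‖ + |f x - c| * ‖gradient G x‖ / 2) * Real.exp (-G x / 2) := by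
  simp_rw [norm_gradient_eq_norm_fderiv]
  have hw : HasFDerivAt (fun y => Real.exp (-G y / 2))
      (Real.exp (-G x / 2) • ((2 : ℝ)⁻¹ • -fderiv ℝ G x)) x := by
    simpa only [div_eq_mul_inv] using (hG.hasFDerivAt.fun_neg.mul_const (2 : ℝ)⁻¹).exp
  have := ((hf.hasFDerivAt.sub_const c).mul hw).fderiv
  change fderiv ℝ (fun y => (f y - c) * Real.exp (-G y / 2)) x = _ at this
  rw [this]
  refine (norm_add_le _ _).trans_eq ?_
  simp only [norm_smul, norm_neg, Real.norm_eq_abs, Real.abs_exp]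
  norm_num
  ring

/-- Products `(f - c) e^{-G/2}` are test functions when `f` and `G` are. -/
theorem IsTestFun.sub_const_mul_exp {f G : En n → ℝ} (hf : IsTestFun f) (hG : IsTestFun G)
    (c : ℝ) : IsTestFun fun x => (f x - c) * Real.exp (-G x / 2) := by
  have hsm : ContDiff ℝ (⊤ : ℕ∞) fun x => (f x - c) * Real.exp (-G x / 2) :=
    (hf.1.sub contDiff_const).mul (hG.1.neg.div_const 2).exp
  obtain ⟨A, hA⟩ := hf.2.1
  obtain ⟨B, hB⟩ := hG.2.1
  obtain ⟨A', hA'⟩ := hf.exists_norm_gradient_le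
  obtain ⟨B', hB'⟩ := hG.exists_norm_gradient_le
  have hfc : ∀ x, |f x - c| ≤ A + |c| := fun x =>
    (abs_sub _ _).trans (by linarith [hA x])
  have hnegG : ∀ x, -G x ≤ B := fun x => (neg_le_abs _).trans (hB x)
  have hA0 : 0 ≤ A + |c| := (abs_nonneg _).trans (hfc 0)
  have hA'0 : 0 ≤ A' := (norm_nonneg _).trans (hA' 0)
  have hB'0 : 0 ≤ B' := (norm_nonneg _).trans (hB' 0)
  have hK : 0 ≤ (A' + (A + |c|) * B' / 2) * Real.exp (B / 2) := by positivity
  refine ⟨hsm, ⟨(A + |c|) * Real.exp (B / 2), fun x => ?_⟩,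
    ⟨((A' + (A + |c|) * B' / 2) * Real.exp (B / 2)).toNNReal, lipschitzWith_of_nnnorm_fderiv_le (𝕜 := ℝ) (hsm.differentiable (by simp))
      fun x => ?_⟩⟩
  · rw [abs_mul, Real.abs_exp]
    gcongr
    exacts [hfc x, hnegG x]
  · rw [← NNReal.coe_le_coe, coe_nnnorm, Real.coe_toNNReal _ hK, ← norm_gradient_eq_norm_fderiv]
    refine (norm_gradient_sub_const_mul_exp_le (hf.differentiable x) (hG.differentiable x)
      c).trans ?_
    gcongr
    exacts [hA' x, hfc x, hB' x, hnegG x]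

theorem Continuous.integrable_of_abs_le {μ : Measure (En n)} [IsFiniteMeasure μ] {g : En n → ℝ}
    (hg : Continuous g) {M : ℝ} (hM : ∀ x, |g x| ≤ M) : Integrable g μ :=
  .of_bound hg.aestronglyMeasurable M (.of_forall hM)

/-- The Poincaré inequality for the perturbation, in unnormalized form, when the potential is
smooth and bounded. -/
theorem PoincareLE.weighted_of_isTestFun {μ : Measure (En n)} [IsProbabilityMeasure μ]
    {C L ε : ℝ} (hC : 0 ≤ C) (hP : PoincareLE μ C) (hε : 0 < ε)
    (hs : (1 / 4) * (1 + ε) * C * L ^ 2 < 1) {G : En n → ℝ} (hG : IsTestFun G)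
    (hGL : ∀ x, ‖gradient G x‖ ≤ L) {f : En n → ℝ} (hf : IsTestFun f) :
    (∫ x, Real.exp (-G x) ∂μ) * (∫ x, Real.exp (-G x) * f x ^ 2 ∂μ)
        - (∫ x, Real.exp (-G x) * f x ∂μ) ^ 2 ≤
      (1 + ε⁻¹) * C / (1 - (1 / 4) * (1 + ε) * C * L ^ 2) *
        ((∫ x, Real.exp (-G x) ∂μ) * ∫ x, Real.exp (-G x) * ‖gradient f x‖ ^ 2 ∂μ) := by
  obtain ⟨A, hA⟩ := hf.2.1
  obtain ⟨A', hA'⟩ := hf.exists_norm_gradient_le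
  obtain ⟨B, hB⟩ := hG.2.1
  have hfc := hf.1.continuous
  have hGc := hG.1.continuous
  have hexp : ∀ x, Real.exp (-G x) ≤ Real.exp B := fun x =>
    Real.exp_le_exp.2 (by linarith [neg_le_of_abs_le (hB x)])
  have hbdd : ∀ {g : En n → ℝ} {M : ℝ}, Continuous g → (∀ x, |g x| ≤ M) →
      Integrable (fun x => Real.exp (-G x) * g x) μ := fun {g M} hg hM =>
    Continuous.integrable_of_abs_le (by fun_prop) (M := Real.exp B * M) fun x => by
      rw [abs_mul, Real.abs_exp]
      exact mul_le_mul (hexp x) (hM x) (abs_nonneg _) (Real.exp_pos _).le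
  have hi0 : Integrable (fun x => Real.exp (-G x)) μ := by
    simpa using hbdd (g := fun _ => 1) (M := 1) continuous_const (by simp)
  have hi1 : Integrable (fun x => Real.exp (-G x) * f x) μ := hbdd hfc hA
  have hi2 : Integrable (fun x => Real.exp (-G x) * f x ^ 2) μ :=
    hbdd (M := A ^ 2) (by fun_prop) fun x => by
      rw [abs_pow]; exact pow_le_pow_left₀ (abs_nonneg _) (hA x) 2
  have hi3 : Integrable (fun x => Real.exp (-G x) * ‖gradient f x‖ ^ 2) μ :=
    hbdd (M := A' ^ 2) (hf.continuous_norm_gradient.pow 2) fun x => by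
      rw [abs_pow, abs_norm]; exact pow_le_pow_left₀ (norm_nonneg _) (hA' x) 2
  -- The centering constant makes `(f - c) e^{-G/2}` have mean zero.
  have hwc : Continuous fun x => Real.exp (-G x / 2) := by fun_prop
  have hwB : ∀ x, |Real.exp (-G x / 2)| ≤ Real.exp (B / 2) := fun x => by
    rw [Real.abs_exp]
    exact Real.exp_le_exp.2 (by linarith [neg_le_of_abs_le (hB x)])
  have hw : Integrable (fun x => Real.exp (-G x / 2)) μ := hwc.integrable_of_abs_le hwB
  have hfw : Integrable (fun x => f x * Real.exp (-G x / 2)) μ :=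
    Continuous.integrable_of_abs_le (hfc.mul hwc) (M := A * Real.exp (B / 2)) fun x => by
      rw [abs_mul]
      exact mul_le_mul (hA x) (hwB x) (abs_nonneg _) ((abs_nonneg _).trans (hA x))
  have hwpos : 0 < ∫ x, Real.exp (-G x / 2) ∂μ := integral_exp_pos hw
  have hZ : 0 < ∫ x, Real.exp (-G x) ∂μ := integral_exp_pos hi0
  obtain ⟨c, hc⟩ : ∃ c : ℝ, ∫ x, (f x - c) * Real.exp (-G x / 2) ∂μ = 0 := by
    refine ⟨(∫ x, f x * Real.exp (-G x / 2) ∂μ) / ∫ x, Real.exp (-G x / 2) ∂μ, ?_⟩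
    simp_rw [sub_mul]
    rw [integral_sub hfw (hw.const_mul _), integral_const_mul, div_mul_cancel₀ _ hwpos.ne',
      sub_self]
  set h : En n → ℝ := fun x => (f x - c) * Real.exp (-G x / 2) with hh
  have hsq : ∀ x, Real.exp (-G x / 2) ^ 2 = Real.exp (-G x) := fun x => by
    rw [← Real.exp_nat_mul]; congr 1; push_cast; ring
  have hh2 : ∀ x, h x ^ 2 =
      Real.exp (-G x) * f x ^ 2 - 2 * c * (Real.exp (-G x) * f x) + c ^ 2 * Real.exp (-G x) :=
    fun x => by simp only [hh, mul_pow, hsq]; ring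
  have hi21 : Integrable (fun x => Real.exp (-G x) * f x ^ 2
      - 2 * c * (Real.exp (-G x) * f x)) μ := hi2.sub (hi1.const_mul _)
  have hi4 : Integrable (fun x => h x ^ 2) μ := by
    simp_rw [hh2]
    exact hi21.fun_add (hi0.const_mul _)
  have hht : IsTestFun h := hf.sub_const_mul_exp hG c
  have hexpand : ∫ x, h x ^ 2 ∂μ = (∫ x, Real.exp (-G x) * f x ^ 2 ∂μ)
      - 2 * c * (∫ x, Real.exp (-G x) * f x ∂μ) + c ^ 2 * ∫ x, Real.exp (-G x) ∂μ := by
    simp_rw [hh2]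
    rw [integral_add hi21 (hi0.const_mul _),
      integral_sub hi2 (hi1.const_mul _), integral_const_mul, integral_const_mul]
  have hpt : ∀ x, ‖gradient h x‖ ^ 2 ≤
      (1 + ε⁻¹) * (Real.exp (-G x) * ‖gradient f x‖ ^ 2)
        + (1 / 4) * (1 + ε) * L ^ 2 * h x ^ 2 := fun x => by
    have h1 : ‖gradient h x‖ ≤ (‖gradient f x‖ + |f x - c| * L / 2) * Real.exp (-G x / 2) := by
      refine (norm_gradient_sub_const_mul_exp_le (hf.differentiable x) (hG.differentiable x)
        c).trans ?_
      gcongr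
      exact hGL x
    have h2 := pow_le_pow_left₀ (norm_nonneg _) h1 2
    rw [mul_pow, hsq] at h2
    refine h2.trans ?_
    have h3 : h x ^ 2 = |f x - c| ^ 2 * Real.exp (-G x) := by
      simp only [hh, mul_pow, hsq, sq_abs]
    have h4 : ∀ a b : ℝ, (a + b) ^ 2 ≤ (1 + ε⁻¹) * a ^ 2 + (1 + ε) * b ^ 2 := fun a b => by
      have : (1 + ε⁻¹) * a ^ 2 + (1 + ε) * b ^ 2 - (a + b) ^ 2 = ε⁻¹ * (a - ε * b) ^ 2 := by
        field_simp
        ring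
      have : 0 ≤ ε⁻¹ * (a - ε * b) ^ 2 := by positivity
      linarith
    rw [h3]
    refine (mul_le_mul_of_nonneg_right (h4 _ _) (Real.exp_pos _).le).trans_eq ?_
    ring
  have hgrad : ∫ x, ‖gradient h x‖ ^ 2 ∂μ ≤
      (1 + ε⁻¹) * (∫ x, Real.exp (-G x) * ‖gradient f x‖ ^ 2 ∂μ)
        + (1 / 4) * (1 + ε) * L ^ 2 * ∫ x, h x ^ 2 ∂μ := by
    rw [← integral_const_mul, ← integral_const_mul,
      ← integral_add (hi3.const_mul _) (hi4.const_mul _)]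
    exact integral_mono_of_nonneg (.of_forall fun x => by positivity)
      ((hi3.const_mul _).add (hi4.const_mul _)) (.of_forall hpt)
  have hPh := hP h hht
  rw [hc] at hPh
  have hCgrad := mul_le_mul_of_nonneg_left hgrad hC
  have hs' : 0 < 1 - (1 / 4) * (1 + ε) * C * L ^ 2 := by linarith
  have hmain : ∫ x, h x ^ 2 ∂μ ≤ (1 + ε⁻¹) * C / (1 - (1 / 4) * (1 + ε) * C * L ^ 2) *
      ∫ x, Real.exp (-G x) * ‖gradient f x‖ ^ 2 ∂μ := by
    rw [div_mul_eq_mul_div, le_div_iff₀ hs']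
    nlinarith
  have hfinal := mul_le_mul_of_nonneg_left hmain hZ.le
  rw [hexpand] at hfinal
  nlinarith [sq_nonneg ((∫ x, Real.exp (-G x) * f x ∂μ) - c * ∫ x, Real.exp (-G x) ∂μ)]

/-- A Lipschitz function is the pointwise limit of bounded smooth functions with the same
Lipschitz constant, whose exponentials are jointly dominated. -/
theorem LipschitzWith.exists_isTestFun_tendsto {F : En n → ℝ} {K : NNReal}
    (hF : LipschitzWith K F) :
    ∃ G : ℕ → En n → ℝ, (∀ k, IsTestFun (G k)) ∧ (∀ k x, ‖gradient (G k) x‖ ≤ K) ∧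
      (∀ k x, Real.exp (-G k x) ≤ Real.exp K * (Real.exp (-F x) + 1)) ∧
      ∀ x, Filter.Tendsto (fun k => G k x) Filter.atTop (𝓝 (F x)) := by
  have htrunc : ∀ k : ℕ, LipschitzWith K fun x => max (min (F x) k) (-(k : ℝ)) := fun k =>
    (hF.min_const k).max_const _
  choose G hGs hGL hGd using fun k : ℕ =>
    (htrunc k).exists_contDiff_abs_sub_le (δ := 1 / ((k : ℝ) + 1)) (by positivity)
  have hδ : ∀ k : ℕ, (K : ℝ) * (1 / ((k : ℝ) + 1)) ≤ K := fun k =>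
    mul_le_of_le_one_right K.2 ((div_le_one (by positivity)).2 (by linarith [k.cast_nonneg (α := ℝ)]))
  refine ⟨G, fun k => ⟨hGs k, ⟨k + K, fun x => ?_⟩, K, hGL k⟩,
    fun k x => norm_gradient_eq_norm_fderiv (G k) x ▸ norm_fderiv_le_of_lipschitz ℝ (hGL k),
    fun k x => ?_, fun x => ?_⟩
  · have h1 := abs_le.1 ((hGd k x).trans (hδ k))
    have h2 : max (min (F x) k) (-(k : ℝ)) ≤ k :=
      max_le (min_le_right _ _) (by linarith [k.cast_nonneg (α := ℝ)])
    have h3 : -(k : ℝ) ≤ max (min (F x) k) (-(k : ℝ)) := le_max_right _ _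
    exact abs_le.2 ⟨by linarith, by linarith⟩
  · have h1 := (abs_le.1 ((hGd k x).trans (hδ k))).1
    have h2 : min (F x) 0 ≤ max (min (F x) k) (-(k : ℝ)) :=
      le_max_of_le_left (min_le_min_left _ k.cast_nonneg)
    calc Real.exp (-G k x) ≤ Real.exp (K + -min (F x) 0) := Real.exp_le_exp.2 (by linarith)
      _ = Real.exp K * Real.exp (-min (F x) 0) := Real.exp_add _ _
      _ ≤ Real.exp K * (Real.exp (-F x) + 1) := by
        gcongr
        rcases min_choice (F x) 0 with h | h <;> rw [h]
        · linarith
        · simpa using (Real.exp_pos (-F x)).le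
  · have hlim : Filter.Tendsto (fun k : ℕ => (K : ℝ) * (1 / ((k : ℝ) + 1))) Filter.atTop (𝓝 0) := by
      simpa using tendsto_one_div_add_atTop_nhds_zero_nat.const_mul (K : ℝ)
    rw [tendsto_iff_norm_sub_tendsto_zero]
    refine squeeze_zero' (.of_forall fun _ => norm_nonneg _) ?_ hlim
    obtain ⟨N, hN⟩ := exists_nat_ge |F x|
    filter_upwards [Filter.eventually_ge_atTop N] with k hk
    have hk' := abs_le.1 (hN.trans (Nat.cast_le.2 hk))
    have := hGd k x
    rwa [min_eq_left hk'.2, max_eq_left hk'.1] at this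

/-- The Poincaré inequality for the perturbation, in unnormalized form. -/
theorem PoincareLE.weighted_of_lipschitzWith {μ : Measure (En n)} [IsProbabilityMeasure μ]
    {C ε : ℝ} {L : NNReal} (hC : 0 ≤ C) (hP : PoincareLE μ C) (hε : 0 < ε)
    (hs : (1 / 4) * (1 + ε) * C * (L : ℝ) ^ 2 < 1) {F : En n → ℝ} (hF : LipschitzWith L F)
    (hFint : Integrable (fun x => Real.exp (-F x)) μ) {f : En n → ℝ} (hf : IsTestFun f) :
    (∫ x, Real.exp (-F x) ∂μ) * (∫ x, Real.exp (-F x) * f x ^ 2 ∂μ)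
        - (∫ x, Real.exp (-F x) * f x ∂μ) ^ 2 ≤
      (1 + ε⁻¹) * C / (1 - (1 / 4) * (1 + ε) * C * (L : ℝ) ^ 2) *
        ((∫ x, Real.exp (-F x) ∂μ) * ∫ x, Real.exp (-F x) * ‖gradient f x‖ ^ 2 ∂μ) := by
  obtain ⟨G, hG, hGL, hGdom, hGlim⟩ := hF.exists_isTestFun_tendsto
  obtain ⟨A, hA⟩ := hf.2.1
  obtain ⟨A', hA'⟩ := hf.exists_norm_gradient_le
  have hlim : ∀ {g : En n → ℝ} {M : ℝ}, Continuous g → (∀ x, |g x| ≤ M) →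
      Filter.Tendsto (fun k => ∫ x, Real.exp (-G k x) * g x ∂μ) Filter.atTop
        (𝓝 (∫ x, Real.exp (-F x) * g x ∂μ)) := fun {g M} hg hM => by
    refine tendsto_integral_of_dominated_convergence
      (fun x => Real.exp L * (Real.exp (-F x) + 1) * M) (fun k => ?_)
      (((hFint.add (integrable_const 1)).const_mul _).mul_const _)
      (fun k => .of_forall fun x => ?_) (.of_forall fun x => ?_)
    · have := (hG k).1.continuous
      exact Continuous.aestronglyMeasurable (by fun_prop)
    · rw [norm_mul, Real.norm_eq_abs, Real.abs_exp]
      exact mul_le_mul (hGdom k x) (hM x) (norm_nonneg _) (by positivity)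
    · exact ((Real.continuous_exp.tendsto _).comp (hGlim x).neg).mul_const _
  have h0 := hlim (g := fun _ => 1) (M := 1) continuous_const (by simp)
  simp only [mul_one] at h0
  have h1 := hlim hf.1.continuous hA
  have h2 := hlim (g := fun x => f x ^ 2) (M := A ^ 2) (hf.1.continuous.pow 2) fun x => by
    rw [abs_pow]; exact pow_le_pow_left₀ (abs_nonneg _) (hA x) 2
  have h3 := hlim (g := fun x => ‖gradient f x‖ ^ 2) (M := A' ^ 2)
    (hf.continuous_norm_gradient.pow 2) fun x => by
      rw [abs_pow, abs_norm]; exact pow_le_pow_left₀ (norm_nonneg _) (hA' x) 2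
  exact le_of_tendsto_of_tendsto' ((h0.mul h2).sub (h1.pow 2)) ((h0.mul h3).const_mul _)
    fun k => hP.weighted_of_isTestFun hC hε hs (hG k) (hGL k) hf

theorem measSupport_eq_support (μ : Measure (En n)) : measSupport μ = μ.support :=
  Set.ext fun x => (Measure.mem_support_iff_forall x).symm

theorem perturb_congr_ae {μ : Measure (En n)} {F G : En n → ℝ} (h : F =ᵐ[μ] G) :
    perturb μ F = perturb μ G := by
  have h1 : ∫ x, Real.exp (-F x) ∂μ = ∫ x, Real.exp (-G x) ∂μ :=
    integral_congr_ae (h.mono fun x hx => by simp only [hx])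
  have h2 : (fun x => ENNReal.ofReal (Real.exp (-F x))) =ᵐ[μ]
      fun x => ENNReal.ofReal (Real.exp (-G x)) := h.mono fun x hx => by simp only [hx]
  rw [perturb, perturb, h1, withDensity_congr_ae h2]

theorem integral_perturb {μ : Measure (En n)} {F : En n → ℝ} (hF : Measurable F)
    (g : En n → ℝ) :
    ∫ x, g x ∂(perturb μ F) =
      (∫ x, Real.exp (-F x) ∂μ)⁻¹ * ∫ x, Real.exp (-F x) * g x ∂μ := by
  have hZ : 0 ≤ ∫ x, Real.exp (-F x) ∂μ := integral_nonneg fun x => (Real.exp_pos _).le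
  rw [perturb, integral_smul_measure, integral_withDensity_eq_integral_toReal_smul
    (by fun_prop) (.of_forall fun _ => ENNReal.ofReal_lt_top), ENNReal.toReal_inv,
    ENNReal.toReal_ofReal hZ, smul_eq_mul]
  simp_rw [ENNReal.toReal_ofReal (Real.exp_pos _).le, smul_eq_mul]

end PoincarePerturbation

/-- If `F` is `L`-Lipschitz on the support of `μ` and
`s := (1/4)(1+ε) C_P(μ) L² < 1` for some `ε > 0`, then
`C_P(μ_F) ≤ (1+ε⁻¹) C_P(μ) / (1-s)`. -/
theorem poincare_of_lipschitz_perturbation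
    {n : ℕ} (μ : Measure (En n)) [IsProbabilityMeasure μ] (V : En n → ℝ)
    (hμ : μ = volume.withDensity fun x => ENNReal.ofReal (Real.exp (-V x)))
    (F : En n → ℝ) (L : ℝ) (hL : 0 ≤ L)
    (hFlip : LipschitzOnWith (Real.toNNReal L) F (measSupport μ))
    (hFint : Integrable (fun x => Real.exp (-F x)) μ)
    (hFpos : 0 < ∫ x, Real.exp (-F x) ∂μ)
    (Cμ : ℝ) (hCμ : 0 ≤ Cμ) (hP : PoincareLE μ Cμ)
    (ε : ℝ) (hε : 0 < ε)
    (hs : (1 / 4) * (1 + ε) * Cμ * L ^ 2 < 1) :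
    PoincareLE (perturb μ F)
      ((1 + ε⁻¹) * Cμ / (1 - (1 / 4) * (1 + ε) * Cμ * L ^ 2)) := by
  obtain ⟨G, hG, hFG⟩ := hFlip.extend_real
  have hae : F =ᵐ[μ] G := by
    filter_upwards [Measure.support_mem_ae (μ := μ)] with x hx
    exact hFG (measSupport_eq_support μ ▸ hx)
  have hexp : (fun x => Real.exp (-F x)) =ᵐ[μ] fun x => Real.exp (-G x) :=
    hae.mono fun x hx => by simp only [hx]
  rw [integrable_congr hexp] at hFint
  rw [integral_congr_ae hexp] at hFpos
  rw [perturb_congr_ae hae]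
  intro f hf
  simp_rw [integral_perturb hG.continuous.measurable]
  have hLL := Real.coe_toNNReal L hL
  have key := hP.weighted_of_lipschitzWith hCμ hε (hLL.symm ▸ hs) hG hFint hf
  rw [hLL] at key
  have := mul_le_mul_of_nonneg_left key (sq_nonneg (∫ x, Real.exp (-G x) ∂μ)⁻¹)
  have hZ := hFpos.ne'
  refine (Eq.trans_le ?_ this).trans_eq ?_
  · field_simp
  · generalize (1 + ε⁻¹) * Cμ / (1 - 1 / 4 * (1 + ε) * Cμ * L ^ 2) = D
    field_simp
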